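/- Let ⟨1, c₂, …, c_m⟩ be a coin system with m ≥ 3. If the system is non-canonical, then its smallest counterexample x satisfies c₃ + 1 < x < c_{m-1} + c_m. -/

import Mathlib

/-- A coin system `⟨c 1, c 2, …, c m⟩` is a strictly increasing finite sequence of
positive integers with `c 1 = 1` (only the values `c i` for `1 ≤ i ≤ m` matter). -/
def IsCoinSystem (m : ℕ) (c : ℕ → ℕ) : Prop :=
  c 1 = 1 ∧ ∀ i j, 1 ≤ i → i < j → j ≤ m → c i < c j

/-- `α` is a representation of `x` under the coin system `⟨c 1, …, c m⟩`. -/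
def IsRepr (m : ℕ) (c : ℕ → ℕ) (x : ℕ) (α : ℕ → ℕ) : Prop :=
  ∑ i ∈ Finset.Icc 1 m, α i * c i = x

/-- The size of a representation, i.e. the total number of coins used. -/
def reprSize (m : ℕ) (α : ℕ → ℕ) : ℕ :=
  ∑ i ∈ Finset.Icc 1 m, α i

/-- `α` is the greedy representation of `x`: a representation such that for every
`2 ≤ i ≤ m` the part of the sum using coins smaller than `c i` is `< c i`. -/
def IsGreedy (m : ℕ) (c : ℕ → ℕ) (x : ℕ) (α : ℕ → ℕ) : Prop :=
  IsRepr m c x α ∧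
    ∀ i, 2 ≤ i → i ≤ m → ∑ j ∈ Finset.Icc 1 (i - 1), α j * c j < c i

/-- `α` is an optimal (minimum-size) representation of `x`. -/
def IsOpt (m : ℕ) (c : ℕ → ℕ) (x : ℕ) (α : ℕ → ℕ) : Prop :=
  IsRepr m c x α ∧ ∀ β, IsRepr m c x β → reprSize m α ≤ reprSize m β

/-- `x` is a counterexample: the greedy representation of `x` is strictly larger
than some representation of `x` (equivalently, than an optimal one). -/
def IsCounterexample (m : ℕ) (c : ℕ → ℕ) (x : ℕ) : Prop :=
  ∃ γ β, IsGreedy m c x γ ∧ IsRepr m c x β ∧ reprSize m β < reprSize m γ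

/-- A coin system is non-canonical if it has a counterexample. -/
def NonCanonical (m : ℕ) (c : ℕ → ℕ) : Prop :=
  ∃ x, IsCounterexample m c x

/-- A coin system is canonical if `|GRD(x)| = |OPT(x)|` for all `x`,
i.e. it has no counterexample. -/
def IsCanonical (m : ℕ) (c : ℕ → ℕ) : Prop :=
  ∀ x, ¬ IsCounterexample m c x

/-- A coin system is tight if it has no counterexample smaller than its largest coin. -/
def Tight (m : ℕ) (c : ℕ → ℕ) : Prop :=
  ∀ x, x < c m → ¬ IsCounterexample m c x

/-- `x` is the smallest counterexample of the coin system. -/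
def SmallestCounterexample (m : ℕ) (c : ℕ → ℕ) (x : ℕ) : Prop :=
  IsCounterexample m c x ∧ ∀ y, y < x → ¬ IsCounterexample m c y

theorem IsRepr.sum_add_single {m : ℕ} {c : ℕ → ℕ} {x : ℕ} {α : ℕ → ℕ} {i : ℕ}
    (h : IsRepr m c x α) (hi : i ∈ Finset.Icc 1 m) :
    IsRepr m c (x + c i) (α + Pi.single i 1) := by
  unfold IsRepr at *
  simp only [Pi.add_apply, add_mul, Finset.sum_add_distrib, h]
  rw [Finset.sum_eq_single_of_mem i hi]
  · simp
  · intro b _ hb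
    simp [hb]

theorem reprSize_add_single {m i : ℕ} (α : ℕ → ℕ) (hi : i ∈ Finset.Icc 1 m) :
    reprSize m (α + Pi.single i 1) = reprSize m α + 1 := by
  unfold reprSize
  simp only [Pi.add_apply, Finset.sum_add_distrib]
  rw [Finset.sum_eq_single_of_mem (f := (Pi.single i 1 : ℕ → ℕ)) i hi]
  · simp
  · intro b _ hb
    simp [hb]

theorem exists_eq_add_single {α : ℕ → ℕ} {i : ℕ} (h : 1 ≤ α i) :
    ∃ α' : ℕ → ℕ, α = α' + Pi.single i 1 := by
  refine ⟨Function.update α i (α i - 1), funext fun j => ?_⟩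
  by_cases hj : j = i
  · subst hj
    simp only [Pi.add_apply, Function.update_self, Pi.single_eq_same]
    omega
  · simp [hj]

/-- A coin that is used can be taken out of a representation. -/
theorem IsRepr.exists_remove {m : ℕ} {c : ℕ → ℕ} {x : ℕ} {α : ℕ → ℕ} {i : ℕ}
    (h : IsRepr m c x α) (hi : i ∈ Finset.Icc 1 m) (hα : 1 ≤ α i) :
    ∃ y α', x = y + c i ∧ α = α' + Pi.single i 1 ∧ IsRepr m c y α' ∧
      reprSize m α = reprSize m α' + 1 := by
  obtain ⟨α', rfl⟩ := exists_eq_add_single hα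
  have hr : IsRepr m c (∑ j ∈ Finset.Icc 1 m, α' j * c j) α' := rfl
  exact ⟨_, α', h.symm.trans (hr.sum_add_single hi), rfl, hr, reprSize_add_single α' hi⟩

theorem IsRepr.exists_pos {m : ℕ} {c : ℕ → ℕ} {x : ℕ} {α : ℕ → ℕ}
    (h : IsRepr m c x α) (hx : 0 < x) : ∃ i ∈ Finset.Icc 1 m, 1 ≤ α i := by
  by_contra! hn
  have : x = 0 := by
    rw [← h]
    exact Finset.sum_eq_zero fun i hi => by simp [Nat.lt_one_iff.mp (hn i hi)]
  omega

theorem IsRepr.eq_zero_of_lt {m : ℕ} {c : ℕ → ℕ} {x : ℕ} {α : ℕ → ℕ} {i : ℕ}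
    (h : IsRepr m c x α) (hi : i ∈ Finset.Icc 1 m) (hx : x < c i) : α i = 0 := by
  by_contra hn
  obtain ⟨y, _, hy, _⟩ := h.exists_remove hi (Nat.one_le_iff_ne_zero.mpr hn)
  omega

theorem IsCoinSystem.one_le {m : ℕ} {c : ℕ → ℕ} (hc : IsCoinSystem m c) {i : ℕ}
    (hi : i ∈ Finset.Icc 1 m) : 1 ≤ c i := by
  rw [Finset.mem_Icc] at hi
  rcases eq_or_lt_of_le hi.1 with h | h
  · rw [← h, hc.1]
  · have := hc.2 1 i le_rfl h hi.2
    omega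

theorem IsCoinSystem.le {m : ℕ} {c : ℕ → ℕ} (hc : IsCoinSystem m c) {i j : ℕ}
    (hi : 1 ≤ i) (hij : i ≤ j) (hj : j ≤ m) : c i ≤ c j := by
  rcases eq_or_lt_of_le hij with h | h
  · rw [h]
  · exact (hc.2 i j hi h hj).le

theorem IsRepr.reprSize_le {m : ℕ} {c : ℕ → ℕ} {x : ℕ} {α : ℕ → ℕ}
    (hc : IsCoinSystem m c) (h : IsRepr m c x α) : reprSize m α ≤ x := by
  rw [← h]
  exact Finset.sum_le_sum fun i hi => Nat.le_mul_of_pos_right _ (hc.one_le hi)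

theorem IsRepr.eq_zero_of_reprSize {m : ℕ} {c : ℕ → ℕ} {x : ℕ} {α : ℕ → ℕ}
    (h : IsRepr m c x α) (hs : reprSize m α = 0) : x = 0 := by
  by_contra hx
  obtain ⟨i, hi, hα⟩ := h.exists_pos (Nat.pos_of_ne_zero hx)
  obtain ⟨_, _, _, _, _, h'⟩ := h.exists_remove hi hα
  omega

/-- The greedy representation of `x` uses the largest coin not exceeding `x`. -/
theorem IsGreedy.one_le_of_largest {m : ℕ} {c : ℕ → ℕ} {x : ℕ} {γ : ℕ → ℕ} {j : ℕ}
    (h : IsGreedy m c x γ) (hj : j ∈ Finset.Icc 1 m) (hx : 0 < x) (hjx : c j ≤ x)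
    (hgt : ∀ i, j < i → i ≤ m → x < c i) : 1 ≤ γ j := by
  by_contra hn
  rw [Finset.mem_Icc] at hj
  have hsum : ∑ i ∈ Finset.Icc 1 (j - 1), γ i * c i = x := by
    refine Eq.trans (Finset.sum_subset ?_ ?_) h.1
    · exact Finset.Icc_subset_Icc le_rfl (by omega)
    · intro i hi hi'
      simp only [Finset.mem_Icc, not_and, not_le] at hi hi'
      have hji := hi' hi.1
      have : γ i = 0 := by
        rcases eq_or_lt_of_le (show j ≤ i by omega) with e | l
        · subst e
          omega
        · exact h.1.eq_zero_of_lt (Finset.mem_Icc.mpr hi) (hgt i l hi.2)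
      simp [this]
  by_cases hj2 : 2 ≤ j
  · have := h.2 j hj2 hj.2
    omega
  · have : j = 1 := by omega
    subst this
    simp at hsum
    omega

/-- Every number has a greedy representation. -/
theorem IsCoinSystem.exists_isGreedy {m : ℕ} {c : ℕ → ℕ} (hm : 1 ≤ m)
    (hc : IsCoinSystem m c) (x : ℕ) : ∃ γ, IsGreedy m c x γ := by
  induction m, hm using Nat.le_induction generalizing x with
  | base =>
    refine ⟨fun _ => x, ?_, fun i _ _ => by omega⟩
    simp [IsRepr, hc.1]
  | succ k hk ih =>
    obtain ⟨γ, hγ, hg⟩ := ih ⟨hc.1, fun i j hi hij hj => hc.2 i j hi hij (by omega)⟩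
      (x % c (k + 1))
    have hpre : ∀ n ≤ k, ∑ j ∈ Finset.Icc 1 n,
        Function.update γ (k + 1) (x / c (k + 1)) j * c j =
          ∑ j ∈ Finset.Icc 1 n, γ j * c j := by
      intro n hn
      refine Finset.sum_congr rfl fun j hj => ?_
      rw [Finset.mem_Icc] at hj
      rw [Function.update_of_ne (by omega)]
    refine ⟨Function.update γ (k + 1) (x / c (k + 1)), ?_, fun i hi him => ?_⟩
    · unfold IsRepr at *
      rw [Finset.sum_Icc_succ_top (by omega), hpre k le_rfl, hγ, Function.update_self]
      exact Nat.mod_add_div' x (c (k + 1))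
    · rw [hpre _ (by omega)]
      rcases eq_or_lt_of_le him with rfl | hlt
      · rw [Nat.add_sub_cancel, hγ]
        exact Nat.mod_lt _ (hc.one_le (Finset.mem_Icc.mpr ⟨by omega, le_rfl⟩))
      · exact hg i hi (by omega)

theorem IsGreedy.isGreedy_remove_last {m : ℕ} {c : ℕ → ℕ} {x : ℕ} {γ : ℕ → ℕ} (hm : 1 ≤ m)
    (h : IsGreedy m c x γ) (hγ : 1 ≤ γ m) :
    ∃ y γ', x = y + c m ∧ IsGreedy m c y γ' ∧ reprSize m γ = reprSize m γ' + 1 := by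
  obtain ⟨y, γ', hy, he, hr, hs⟩ := h.1.exists_remove (Finset.mem_Icc.mpr ⟨hm, le_rfl⟩) hγ
  refine ⟨y, γ', hy, ⟨hr, fun i hi him => ?_⟩, hs⟩
  refine lt_of_le_of_lt (Finset.sum_le_sum fun j _ => ?_) (h.2 i hi him)
  rw [he]
  exact Nat.mul_le_mul_right _ (Nat.le_add_right _ _)

/-- A representation that beats the greedy one for the smallest counterexample
does not use the largest coin. -/
theorem SmallestCounterexample.last_eq_zero {m : ℕ} {c : ℕ → ℕ} {x : ℕ} {γ β : ℕ → ℕ}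
    (hm : 1 ≤ m) (hc : IsCoinSystem m c) (hx : SmallestCounterexample m c x)
    (hγ : IsGreedy m c x γ) (hβ : IsRepr m c x β) (hlt : reprSize m β < reprSize m γ) :
    β m = 0 := by
  by_contra hn
  have hmm : m ∈ Finset.Icc 1 m := Finset.mem_Icc.mpr ⟨hm, le_rfl⟩
  have hpos := hc.one_le hmm
  obtain ⟨y, β', hy, -, hr, hs⟩ := hβ.exists_remove hmm (Nat.one_le_iff_ne_zero.mpr hn)
  obtain ⟨z, γ', hz, hg, hs'⟩ := hγ.isGreedy_remove_last hm
    (hγ.one_le_of_largest hmm (by omega) (by omega) fun i _ _ => by omega)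
  obtain rfl : y = z := by omega
  exact hx.2 y (by omega) ⟨γ', β', hg, hr, by omega⟩

theorem SmallestCounterexample.lt_add {m : ℕ} {c : ℕ → ℕ} {x : ℕ} (hm : 2 ≤ m)
    (hc : IsCoinSystem m c) (hx : SmallestCounterexample m c x) : x < c (m - 1) + c m := by
  by_contra! hle
  have hmm : m ∈ Finset.Icc 1 m := Finset.mem_Icc.mpr ⟨by omega, le_rfl⟩
  have hpos := hc.one_le hmm
  obtain ⟨γ, β, hγ, hβ, hlt⟩ := hx.1
  have hβm := hx.last_eq_zero (by omega) hc hγ hβ hlt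
  obtain ⟨i, hi, hβi⟩ := hβ.exists_pos (by omega)
  obtain ⟨y, β', hy, -, hr, hs⟩ := hβ.exists_remove hi hβi
  have hipos := hc.one_le hi
  have hi' := Finset.mem_Icc.mp hi
  have him : i ≠ m := by
    rintro rfl
    omega
  have hci := hc.le hi'.1 (show i ≤ m - 1 by omega) (by omega)
  obtain ⟨δ, hδ⟩ := hc.exists_isGreedy (by omega) y
  have hδs : reprSize m δ ≤ reprSize m β' := by
    by_contra! h
    exact hx.2 y (by omega) ⟨δ, β', hδ, hr, h⟩
  have hδm := hδ.one_le_of_largest hmm (by omega) (by omega) fun j _ _ => by omega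
  have hadd := hδ.1.sum_add_single hi
  rw [← hy] at hadd
  have hzero := hx.last_eq_zero (by omega) hc hγ hadd
    (by rw [reprSize_add_single δ hi]; omega)
  simp only [Pi.add_apply] at hzero
  omega

/-- An amount at most one above a largest fitting coin is no counterexample. -/
theorem IsCounterexample.add_one_lt {m : ℕ} {c : ℕ → ℕ} {x j : ℕ} (hc : IsCoinSystem m c)
    (hx : IsCounterexample m c x) (hj : j ∈ Finset.Icc 1 m) (hjx : c j ≤ x)
    (hgt : ∀ i, j < i → i ≤ m → x < c i) : c j + 1 < x := by
  by_contra! hle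
  obtain ⟨γ, β, hγ, hβ, hlt⟩ := hx
  have hpos := hc.one_le hj
  obtain ⟨y, γ', hy, -, hr, hs⟩ := hγ.1.exists_remove hj
    (hγ.one_le_of_largest hj (by omega) hjx hgt)
  have hγ' := hr.reprSize_le hc
  obtain ⟨i, hi, hβi⟩ := hβ.exists_pos (by omega)
  obtain ⟨z, β', hz, -, hr', hs'⟩ := hβ.exists_remove hi hβi
  have hz0 := hr'.eq_zero_of_reprSize (by omega)
  rw [Finset.mem_Icc] at hi hj
  have hij : i ≤ j := by
    by_contra! h
    have := hgt i h hi.2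
    omega
  have := hc.le hi.1 hij hj.2
  omega

theorem IsRepr.eq_of_lt_three {m : ℕ} {c : ℕ → ℕ} {x : ℕ} {α : ℕ → ℕ} (hm : 3 ≤ m)
    (hc : IsCoinSystem m c) (h : IsRepr m c x α) (hx : x < c 3) :
    x = α 1 + α 2 * c 2 ∧ reprSize m α = α 1 + α 2 := by
  have hsub : Finset.Icc 1 2 ⊆ Finset.Icc 1 m := Finset.Icc_subset_Icc le_rfl (by omega)
  have hz : ∀ i ∈ Finset.Icc 1 m, i ∉ Finset.Icc 1 2 → α i = 0 := by
    intro i hi hi'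
    refine h.eq_zero_of_lt hi (lt_of_lt_of_le hx ?_)
    simp only [Finset.mem_Icc, not_and, not_le] at hi hi'
    exact hc.le (by omega) (hi' hi.1) hi.2
  constructor
  · rw [← h, ← Finset.sum_subset hsub fun i hi hi' => by simp [hz i hi hi'],
      Finset.sum_Icc_succ_top (by omega)]
    simp [hc.1]
  · rw [reprSize, ← Finset.sum_subset hsub hz, Finset.sum_Icc_succ_top (by omega)]
    simp

theorem IsCounterexample.three_le {m : ℕ} {c : ℕ → ℕ} {x : ℕ} (hm : 3 ≤ m)
    (hc : IsCoinSystem m c) (hx : IsCounterexample m c x) : c 3 ≤ x := by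
  by_contra! hlt3
  obtain ⟨γ, β, hγ, hβ, hlt⟩ := hx
  obtain ⟨e₁, s₁⟩ := hγ.1.eq_of_lt_three hm hc hlt3
  obtain ⟨e₂, s₂⟩ := hβ.eq_of_lt_three hm hc hlt3
  have hγ1 : γ 1 < c 2 := by
    have := hγ.2 2 le_rfl (by omega)
    simpa [hc.1] using this
  have h2 : 1 ≤ c 2 := by omega
  rcases le_or_gt (β 2) (γ 2) with h | h
  · obtain ⟨d, hd⟩ := Nat.exists_eq_add_of_le h
    rw [hd] at e₁ s₁
    nlinarith
  · obtain ⟨d, hd⟩ := Nat.exists_eq_add_of_lt h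
    rw [hd] at e₂
    nlinarith

theorem IsCounterexample.three_add_one_lt {m : ℕ} {c : ℕ → ℕ} {x : ℕ} (hm : 3 ≤ m)
    (hc : IsCoinSystem m c) (hx : IsCounterexample m c x) : c 3 + 1 < x := by
  have h3 := hx.three_le hm hc
  let p : ℕ → Prop := fun j => 3 ≤ j ∧ c j ≤ x
  classical
  have hspec : p (Nat.findGreatest p m) := Nat.findGreatest_spec hm ⟨le_rfl, h3⟩
  have hle := Nat.findGreatest_le (P := p) m
  have hgt : ∀ i, Nat.findGreatest p m < i → i ≤ m → x < c i := by
    intro i hi him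
    by_contra! h
    exact Nat.findGreatest_is_greatest hi him ⟨by have := hspec.1; omega, h⟩
  have := hx.add_one_lt hc (Finset.mem_Icc.mpr ⟨by have := hspec.1; omega, hle⟩) hspec.2 hgt
  have := hc.le (by omega) hspec.1 hle
  omega

/-- Kozen–Zaks: the smallest counterexample of a non-canonical coin system lies in
the range `c 3 + 1 < x < c (m-1) + c m`. -/
theorem stmt_2 (m : ℕ) (c : ℕ → ℕ) (hm : 3 ≤ m) (hc : IsCoinSystem m c)
    (x : ℕ) (hx : SmallestCounterexample m c x) :
    c 3 + 1 < x ∧ x < c (m - 1) + c m := by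
  exact ⟨hx.1.three_add_one_lt hm hc, hx.lt_add (by omega) hc⟩
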